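/- The matrix ρ3 is entangled: it is not separable, i.e. ¬(SN(ρ3) ≤ 1); equivalently, ρ3 cannot be written as a finite sum Σ_t v_t v_t* with every v_t of Schmidt rank 1. -/

import Mathlib

open Matrix Kronecker ComplexOrder

/-- The Schmidt rank of a vector `ψ ∈ ℂ^(Fin m × Fin n)`: the rank of the associated
`m × n` matrix with `(i,j)` entry `ψ (i,j)`. -/
noncomputable def schmidtRank {m n : ℕ} (ψ : Fin m × Fin n → ℂ) : ℕ :=
  (Matrix.of fun i j => ψ (i, j) : Matrix (Fin m) (Fin n) ℂ).rank

/-- Rank-one outer product `v v*`. -/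
def outer {d : Type*} (v : d → ℂ) : Matrix d d ℂ :=
  Matrix.of fun a b => v a * star (v b)

/-- `SNle ρ k` : the Schmidt number of `ρ` is at most `k`, i.e. `ρ` is a finite sum of
outer products of vectors of Schmidt rank at most `k`. -/
def SNle {m n : ℕ} (ρ : Matrix (Fin m × Fin n) (Fin m × Fin n) ℂ) (k : ℕ) : Prop :=
  ∃ (T : ℕ) (v : Fin T → (Fin m × Fin n → ℂ)),
    (∀ t, schmidtRank (v t) ≤ k) ∧ ρ = ∑ t, outer (v t)

/-- Partial transpose on the second (B) subsystem. -/
def ptB {m n : ℕ} (ρ : Matrix (Fin m × Fin n) (Fin m × Fin n) ℂ) :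
    Matrix (Fin m × Fin n) (Fin m × Fin n) ℂ :=
  Matrix.of fun p q => ρ (p.1, q.2) (q.1, p.2)

/-- Partial transpose on the first (A) subsystem. -/
def ptA {m n : ℕ} (ρ : Matrix (Fin m × Fin n) (Fin m × Fin n) ℂ) :
    Matrix (Fin m × Fin n) (Fin m × Fin n) ℂ :=
  Matrix.of fun p q => ρ (q.1, p.2) (p.1, q.2)


/-- Standard basis vector of `ℂ^(Fin 3 × Fin 3)`. -/
def eb (q : Fin 3 × Fin 3) : Fin 3 × Fin 3 → ℂ := fun p => if p = q then 1 else 0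

/-- The generalized grid state `ρ^{3×3}`. -/
noncomputable def rho3 : Matrix (Fin 3 × Fin 3) (Fin 3 × Fin 3) ℂ :=
  outer (eb (0, 0) + eb (1, 1) + eb (2, 2))
  + outer (eb (0, 1) + eb (1, 2))
  + outer (eb (1, 0) - eb (2, 1))
  + (3 : ℂ) • outer (eb (0, 2))
  + (3 : ℂ) • outer (eb (2, 0))


lemma minor_zero (v : Fin 3 × Fin 3 → ℂ) (h : schmidtRank v ≤ 1) (i j k l : Fin 3) :
    v (i, k) * v (j, l) = v (i, l) * v (j, k) := by
  unfold schmidtRank at h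
  rw [Matrix.rank_eq_finrank_span_row, finrank_le_one_iff] at h
  obtain ⟨w, hw⟩ := h
  obtain ⟨c, hc⟩ := hw ⟨_, Submodule.subset_span (Set.mem_range_self i)⟩
  obtain ⟨d, hd⟩ := hw ⟨_, Submodule.subset_span (Set.mem_range_self j)⟩
  have hc' := congrArg Subtype.val hc
  have hd' := congrArg Subtype.val hd
  have e1 : ∀ k, c * w.1 k = v (i, k) := fun k => congrFun hc' k
  have e2 : ∀ k, d * w.1 k = v (j, k) := fun k => congrFun hd' k
  rw [← e1, ← e1, ← e2, ← e2]
  ring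

lemma ker_zero {T : ℕ} (v : Fin T → (Fin 3 × Fin 3 → ℂ)) (hv : rho3 = ∑ t, outer (v t))
    (a b : Fin 3 × Fin 3) (s : ℂ)
    (h : rho3 a a + star s * rho3 a b + s * rho3 b a + s * star s * rho3 b b = 0) (t : Fin T) :
    v t a + s * v t b = 0 := by
  have h2 : ∑ t, (v t a + s * v t b) * star (v t a + s * v t b) = 0 := by
    rw [← h, hv]
    simp only [Matrix.sum_apply, outer, Matrix.of_apply, Finset.mul_sum, ← Finset.sum_add_distrib]
    refine Finset.sum_congr rfl fun t _ => ?_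
    simp only [star_add, star_mul']
    ring
  rw [Finset.sum_eq_zero_iff_of_nonneg (fun t _ => mul_star_self_nonneg _)] at h2
  rcases mul_eq_zero.mp (h2 t (Finset.mem_univ t)) with h3 | h3
  · exact h3
  · exact star_eq_zero.mp h3

/-- `ρ^{3×3}` is entangled: it is not separable. -/
theorem rho3_entangled : ¬ SNle rho3 1 := by
  rintro ⟨T, v, hr, hv⟩
  have h0 : ∀ t, v t (0, 0) = 0 := by
    intro t
    have h1 := ker_zero v hv (0, 0) (1, 1) (-1) (by simp [rho3, outer, eb]) t
    have h2 := ker_zero v hv (0, 0) (2, 2) (-1) (by simp [rho3, outer, eb]) t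
    have h3 := ker_zero v hv (0, 1) (1, 2) (-1) (by simp [rho3, outer, eb]) t
    have h4 := ker_zero v hv (1, 0) (2, 1) 1 (by simp [rho3, outer, eb]) t
    have m1 := minor_zero (v t) (hr t) 0 1 0 1
    have m2 := minor_zero (v t) (hr t) 1 2 1 2
    have e1 : v t (1, 1) = v t (0, 0) := by linear_combination -h1
    have e2 : v t (2, 2) = v t (0, 0) := by linear_combination -h2
    have e3 : v t (1, 2) = v t (0, 1) := by linear_combination -h3
    have e4 : v t (2, 1) = - v t (1, 0) := by linear_combination h4
    rw [e1] at m1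
    rw [e1, e2, e3, e4] at m2
    have : v t (0, 0) * v t (0, 0) = 0 := by linear_combination (m1 + m2) / 2
    simpa using this
  have := congrFun (congrFun hv (0, 0)) (0, 0)
  simp [Matrix.sum_apply, outer, h0, rho3, eb] at this
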